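/- arXiv:1108.0072 — 4 statements merged into one kernel-verified Lean document; each statement's English description precedes it below -/
import Mathlib

section
/- Let γ : ℝ → ℝ² be a curve in the Euclidean plane, let d ∈ ℝ² be a destination point, let v > 0 and 0 ≤ θ_c < π/2. Assume γ is continuous, and that at every time s ≥ 0 with γ(s) ≠ d, γ is differentiable at s with ‖γ'(s)‖ = v and the angle between γ'(s) and d − γ(s) is at most θ_c. Then there exists a time t with 0 ≤ t ≤ dist(γ(0), d) / (v·cos θ_c) such that γ(t) = d. -/
open Real InnerProductGeometry

/-- Theorem 1 (delivery delay bound): a relay moving at constant speed `v` whose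
relative bearing angle to the destination `d` stays below `θc < π/2` reaches `d`
within time `dist (γ 0) d / (v * cos θc)`. -/
theorem delivery_delay_bound
    (γ : ℝ → EuclideanSpace ℝ (Fin 2)) (d : EuclideanSpace ℝ (Fin 2))
    (v θc : ℝ) (hv : 0 < v) (hθc0 : 0 ≤ θc) (hθc : θc < Real.pi / 2)
    (hcont : Continuous γ)
    (hmove : ∀ s : ℝ, 0 ≤ s → γ s ≠ d →
      ∃ g : EuclideanSpace ℝ (Fin 2), HasDerivAt γ g s ∧ ‖g‖ = v ∧
        InnerProductGeometry.angle g (d - γ s) ≤ θc) :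
    ∃ t : ℝ, 0 ≤ t ∧ t ≤ dist (γ 0) d / (v * Real.cos θc) ∧ γ t = d := by
  have hc : 0 < Real.cos θc := Real.cos_pos_of_mem_Ioo ⟨by linarith [Real.pi_pos], hθc⟩
  have hk : 0 < v * Real.cos θc := mul_pos hv hc
  by_contra hcon
  push Not at hcon
  set T := dist (γ 0) d / (v * Real.cos θc) with hT
  have hT0 : 0 ≤ T := div_nonneg dist_nonneg hk.le
  have key : ∀ s ∈ Set.Icc 0 T, ∃ m : ℝ, HasDerivAt (fun t => ‖d - γ t‖) m s ∧
      m ≤ -(v * Real.cos θc) := by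
    intro s hs
    have hne := hcon s hs.1 hs.2
    obtain ⟨g, hg, hgv, hang⟩ := hmove s hs.1 hne
    have hpos : 0 < ‖d - γ s‖ := norm_pos_iff.2 (sub_ne_zero.2 hne.symm)
    have h1 := (hg.const_sub d).norm_sq
    have h2 := h1.sqrt (by positivity)
    simp only [Real.sqrt_sq (norm_nonneg _)] at h2
    refine ⟨_, h2, ?_⟩
    have hcos : Real.cos θc ≤ Real.cos (InnerProductGeometry.angle g (d - γ s)) :=
      Real.cos_le_cos_of_nonneg_of_le_pi (InnerProductGeometry.angle_nonneg _ _)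
        (by linarith [Real.pi_pos]) hang
    have h3 := InnerProductGeometry.cos_angle_mul_norm_mul_norm g (d - γ s)
    rw [inner_neg_right, real_inner_comm, ← h3, hgv, div_le_iff₀ (by positivity)]
    have := mul_le_mul_of_nonneg_right hcos (mul_pos hv hpos).le
    nlinarith
  choose! m hm hm' using key
  have hfin := image_le_of_deriv_right_le_deriv_boundary (f := fun t => ‖d - γ t‖) (f' := m)
    (a := 0) (b := T) (B := fun t => ‖d - γ 0‖ + -(v * Real.cos θc) * t)
    (B' := fun _ => -(v * Real.cos θc))
    (by fun_prop) (fun x hx => (hm x ⟨hx.1, hx.2.le⟩).hasDerivWithinAt) (by simp)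
    (by fun_prop)
    (fun x _ => by
      simpa using (((hasDerivAt_id x).const_mul (-(v * Real.cos θc))).const_add
        ‖d - γ 0‖).hasDerivWithinAt)
    (fun x hx => hm' x ⟨hx.1, hx.2.le⟩) (Set.right_mem_Icc.2 hT0)
  have hTe : v * Real.cos θc * T = ‖d - γ 0‖ := by
    rw [hT, mul_div_cancel₀ _ hk.ne', dist_comm, dist_eq_norm]
  have hz : ‖d - γ T‖ ≤ 0 := by
    linarith
  exact hcon T hT0 le_rfl (sub_eq_zero.1 (norm_le_zero_iff.1 hz)).symm
end

section
/- Let γ : ℝ → ℝ² be a curve in the Euclidean plane, d ∈ ℝ², v > 0, 0 ≤ θ_c < π/2, and T ≥ 0. Assume that for every s ∈ [0, T], γ(s) ≠ d, γ is differentiable at s with ‖γ'(s)‖ = v, and the angle between γ'(s) and d − γ(s) is at most θ_c. Then dist(γ(T), d) ≤ dist(γ(0), d) − v·cos(θ_c)·T. -/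
open Real InnerProductGeometry

/-- Key decay estimate for Theorem 1: as long as the bearing angle stays below
`θc`, the distance to the destination decreases at rate at least `v * cos θc`. -/
theorem distance_decay_bound
    (γ : ℝ → EuclideanSpace ℝ (Fin 2)) (d : EuclideanSpace ℝ (Fin 2))
    (v θc T : ℝ) (hv : 0 < v) (hθc0 : 0 ≤ θc) (hθc : θc < Real.pi / 2)
    (hT : 0 ≤ T)
    (hmove : ∀ s ∈ Set.Icc (0 : ℝ) T, γ s ≠ d ∧
      ∃ g : EuclideanSpace ℝ (Fin 2), HasDerivAt γ g s ∧ ‖g‖ = v ∧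
        InnerProductGeometry.angle g (d - γ s) ≤ θc) :
    dist (γ T) d ≤ dist (γ 0) d - v * Real.cos θc * T := by
  have key : ∀ s ∈ Set.Icc (0 : ℝ) T, ∃ f' : ℝ,
      HasDerivAt (fun t => ‖d - γ t‖) f' s ∧ f' ≤ -(v * Real.cos θc) := by
    intro s hs
    obtain ⟨hne, g, hg, hgv, hang⟩ := hmove s hs
    have hpos : 0 < ‖d - γ s‖ := norm_pos_iff.mpr (sub_ne_zero.mpr (Ne.symm hne))
    have h1 : HasDerivAt (fun t => d - γ t) (-g) s := hg.const_sub d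
    have h2 := h1.norm_sq.sqrt (by positivity)
    have h3 : (fun t => √(‖d - γ t‖ ^ 2)) = fun t => ‖d - γ t‖ := by
      funext t
      exact Real.sqrt_sq (norm_nonneg _)
    refine ⟨_, h3 ▸ h2, ?_⟩
    have hcos : Real.cos θc ≤ Real.cos (InnerProductGeometry.angle g (d - γ s)) :=
      Real.cos_le_cos_of_nonneg_of_le_pi (InnerProductGeometry.angle_nonneg _ _)
        (by linarith [Real.pi_pos]) hang
    have hin := InnerProductGeometry.cos_angle_mul_norm_mul_norm g (d - γ s)
    rw [hgv] at hin
    have hm := mul_le_mul_of_nonneg_right hcos (mul_pos hv hpos).le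
    rw [Real.sqrt_sq (norm_nonneg _), div_le_iff₀ (by positivity), inner_neg_right,
      real_inner_comm]
    linarith
  choose! f' hf' hb using key
  have main := image_le_of_deriv_right_le_deriv_boundary
    (f := fun t => ‖d - γ t‖) (f' := f') (a := 0) (b := T)
    (B := fun t => ‖d - γ 0‖ - v * Real.cos θc * t) (B' := fun _ => -(v * Real.cos θc))
    (fun x hx => (hf' x hx).continuousAt.continuousWithinAt)
    (fun x hx => (hf' x (Set.Ico_subset_Icc_self hx)).hasDerivWithinAt)
    (by simp) (by fun_prop)
    (fun x _ => by
      have := ((hasDerivAt_id x).const_mul (v * Real.cos θc)).const_sub ‖d - γ 0‖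
      simpa using this.hasDerivWithinAt)
    (fun x hx => hb x (Set.Ico_subset_Icc_self hx))
    (Set.right_mem_Icc.mpr hT)
  simpa [dist_eq_norm, norm_sub_rev] using main
end

section
/- Let A, D be distinct points of the Euclidean plane, let r = dist(A, D), let u be a unit vector, and let θ be the angle between u and D − A. Assume 0 < θ < θ_c < π/2, and set t* = r·cos θ − r·sin θ / tan θ_c. Then t* ≥ 0, the angle between u and D − (A + t*·u) equals θ_c, and dist(A + t*·u, D) = r·sin θ / sin θ_c. -/
open Real InnerProductGeometry

/-- Geometric core of Theorem 3 (pass-over event): a relay starting at `A` at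
distance `r` from the destination `D`, with unit heading `u` and bearing angle
`θ` satisfying `0 < θ < θc < π/2`, reaches bearing angle exactly `θc` at time
`t* = r·cos θ − r·sin θ / tan θc`, at distance `r·sin θ / sin θc` from `D`. -/
theorem pass_over_event
    (A D : EuclideanSpace ℝ (Fin 2)) (hAD : A ≠ D)
    (u : EuclideanSpace ℝ (Fin 2)) (hu : ‖u‖ = 1)
    (θc : ℝ) (hθc0 : 0 < θc) (hθc : θc < Real.pi / 2)
    (r : ℝ) (hr : r = dist A D)
    (θ : ℝ) (hθ : θ = InnerProductGeometry.angle u (D - A))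
    (hθ0 : 0 < θ) (hθθc : θ < θc)
    (tstar : ℝ) (htstar : tstar = r * Real.cos θ - r * Real.sin θ / Real.tan θc) :
    0 ≤ tstar ∧
      InnerProductGeometry.angle u (D - (A + tstar • u)) = θc ∧
      dist (A + tstar • u) D = r * Real.sin θ / Real.sin θc := by
  have hpi := Real.pi_pos
  have hs : 0 < Real.sin θ := Real.sin_pos_of_pos_of_lt_pi hθ0 (by linarith)
  have hsc : 0 < Real.sin θc := Real.sin_pos_of_pos_of_lt_pi hθc0 (by linarith)
  have hcc : 0 < Real.cos θc := Real.cos_pos_of_mem_Ioo ⟨by linarith, hθc⟩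
  have hrpos : 0 < r := by rw [hr]; exact dist_pos.mpr hAD
  have hv : ‖D - A‖ = r := by rw [hr, dist_comm, dist_eq_norm]
  have hin : inner ℝ u (D - A) = r * Real.cos θ := by
    have h := InnerProductGeometry.cos_angle_mul_norm_mul_norm u (D - A)
    rw [← hθ, hu, hv] at h
    linarith
  have ht : tstar = r * Real.cos θ - r * Real.sin θ * Real.cos θc / Real.sin θc := by
    rw [htstar, Real.tan_eq_sin_div_cos]
    field_simp
  have hw : D - (A + tstar • u) = (D - A) - tstar • u := by abel
  have hinw : inner ℝ u (D - (A + tstar • u)) = r * Real.sin θ / Real.sin θc * Real.cos θc := by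
    rw [hw, inner_sub_right, inner_smul_right, real_inner_self_eq_norm_sq, hu, hin, ht]
    ring
  have hnn : 0 < r * Real.sin θ / Real.sin θc := by positivity
  have hnorm : ‖D - (A + tstar • u)‖ = r * Real.sin θ / Real.sin θc := by
    have h2 : ‖D - (A + tstar • u)‖ ^ 2 = (r * Real.sin θ / Real.sin θc) ^ 2 := by
      rw [hw, norm_sub_sq_real, inner_smul_right, real_inner_comm, hin, norm_smul, hu, hv,
        mul_one, Real.norm_eq_abs, sq_abs]
      have e1 : r ^ 2 - 2 * (tstar * (r * Real.cos θ)) + tstar ^ 2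
          = (r * Real.cos θ - tstar) ^ 2 + r ^ 2 * Real.sin θ ^ 2 := by
        rw [Real.sin_sq]; ring
      rw [e1, ht]
      field_simp
      linear_combination (Real.sin θ ^ 2) * Real.sin_sq_add_cos_sq θc
    exact (pow_left_inj₀ (norm_nonneg _) hnn.le two_ne_zero).mp h2
  refine ⟨?_, ?_, ?_⟩
  · have h : tstar = r * Real.sin (θc - θ) / Real.sin θc := by
      rw [ht, Real.sin_sub]
      field_simp
    have := Real.sin_pos_of_pos_of_lt_pi (sub_pos.mpr hθθc) (by linarith)
    rw [h]
    positivity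
  · unfold InnerProductGeometry.angle
    rw [hinw, hnorm, hu, one_mul, mul_div_cancel_left₀ _ hnn.ne']
    exact Real.arccos_cos hθc0.le (by linarith)
  · rw [dist_comm, dist_eq_norm, hnorm]
end

section
/- Let A, D be distinct points of the Euclidean plane, let r = dist(A, D), let u be a unit vector, and let θ be the angle between u and D − A. Assume 0 < θ < θ_c < π/2, and set t* = r·cos θ − r·sin θ / tan θ_c. Then for every t ∈ [0, t*], the angle between u and D − (A + t·u) is at most θ_c. -/
open Real InnerProductGeometry

/-- Until the pass-over time `t* = r·cos θ − r·sin θ / tan θc`, the relative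
bearing angle of a relay moving along a straight line stays at most `θc`. -/
theorem bearing_angle_le_until_pass_over
    (A D : EuclideanSpace ℝ (Fin 2)) (hAD : A ≠ D)
    (u : EuclideanSpace ℝ (Fin 2)) (hu : ‖u‖ = 1)
    (θc : ℝ) (hθc0 : 0 < θc) (hθc : θc < Real.pi / 2)
    (r : ℝ) (hr : r = dist A D)
    (θ : ℝ) (hθ : θ = InnerProductGeometry.angle u (D - A))
    (hθ0 : 0 < θ) (hθθc : θ < θc)
    (tstar : ℝ) (htstar : tstar = r * Real.cos θ - r * Real.sin θ / Real.tan θc) :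
    ∀ t ∈ Set.Icc (0 : ℝ) tstar,
      InnerProductGeometry.angle u (D - (A + t • u)) ≤ θc := by
  rintro t ⟨-, ht⟩
  have hpi := Real.pi_pos
  have hs : 0 < Real.sin θc := Real.sin_pos_of_pos_of_lt_pi hθc0 (by linarith)
  have hc : 0 < Real.cos θc := Real.cos_pos_of_mem_Ioo ⟨by linarith, hθc⟩
  have hsθ : 0 < Real.sin θ := Real.sin_pos_of_pos_of_lt_pi hθ0 (by linarith)
  have hrn : r = ‖D - A‖ := by rw [hr, dist_comm, dist_eq_norm]
  have hrpos : 0 < r := by rw [hr]; exact dist_pos.mpr hAD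
  have hin : inner ℝ u (D - A) = r * Real.cos θ := by
    have h := InnerProductGeometry.cos_angle_mul_norm_mul_norm u (D - A)
    rw [← hθ, ← hrn, hu] at h
    linarith
  have hv : D - (A + t • u) = (D - A) - t • u := by abel
  rw [hv]
  have hiv : inner ℝ u ((D - A) - t • u) = r * Real.cos θ - t := by
    rw [inner_sub_right, hin, real_inner_smul_right, real_inner_self_eq_norm_sq, hu]
    ring
  have hnv : ‖(D - A) - t • u‖ ^ 2 = (r * Real.cos θ - t) ^ 2 + (r * Real.sin θ) ^ 2 := by
    rw [norm_sub_sq_real, real_inner_smul_right, real_inner_comm, hin, ← hrn, norm_smul, hu,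
      mul_one, Real.norm_eq_abs, sq_abs]
    linear_combination -r ^ 2 * Real.sin_sq_add_cos_sq θ
  have hy : 0 < r * Real.sin θ := mul_pos hrpos hsθ
  have hxy : r * Real.sin θ * Real.cos θc ≤ (r * Real.cos θ - t) * Real.sin θc := by
    have h1 : r * Real.sin θ / Real.tan θc ≤ r * Real.cos θ - t := by linarith
    rw [Real.tan_eq_sin_div_cos, div_div_eq_mul_div, div_le_iff₀ hs] at h1
    exact h1
  generalize (D - A) - t • u = v at *
  generalize r * Real.cos θ - t = x at *
  generalize r * Real.sin θ = y at *
  have hx : 0 < x := by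
    by_contra! h
    nlinarith [mul_pos hy hc]
  have hvpos : 0 < ‖v‖ := by
    by_contra! h
    have : ‖v‖ = 0 := le_antisymm h (norm_nonneg _)
    rw [this] at hnv
    nlinarith
  have hsq : (y * Real.cos θc) ^ 2 ≤ (x * Real.sin θc) ^ 2 :=
    pow_le_pow_left₀ (mul_pos hy hc).le hxy 2
  have key : Real.cos θc * ‖v‖ ≤ x := by
    refine abs_le_of_sq_le_sq' ?_ hx.le |>.2
    rw [mul_pow, hnv]
    have h2 := Real.sin_sq θc
    rw [mul_pow, mul_pow, h2] at hsq
    linarith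
  unfold InnerProductGeometry.angle
  rw [hiv, hu, one_mul, ← Real.arccos_cos hθc0.le (by linarith : θc ≤ Real.pi)]
  apply Real.arccos_le_arccos
  rwa [le_div_iff₀ hvpos]
end
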